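/- arXiv:2308.13886 — 2 statements merged into one kernel-verified Lean document; each statement's English description precedes it below -/
import Mathlib

section
/- Let (X,𝔅) be a measurable space and P a Markov kernel on X, with m-step iterates Pᵐ defined by P¹=P and Pᵐ⁺¹(x,A)=∫ Pᵐ(y,A) P(x,dy). Call P irreducible if there exists a nontrivial σ-finite measure φ on X such that for every A∈𝔅 with φ(A)>0 and every x∈X, Σ_{m≥1} Pᵐ(x,A) > 0. Call a measure μ on X invariant if ∫ P(x,A) dμ(x) = μ(A) for every A∈𝔅. If P is irreducible and admits an invariant probability measure π, then every σ-finite invariant measure μ of P equals c·π for some constant c∈[0,∞); in particular, π is the unique invariant probability measure. -/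
open MeasureTheory ProbabilityTheory
open scoped ENNReal

lemma aux_iter {X : Type*} [MeasurableSpace X]
    (P : Kernel X X) (Q : ℕ → Kernel X X) (hQ1 : Q 1 = P)
    (hQs : ∀ m, 1 ≤ m → ∀ x (A : Set X), MeasurableSet A →
      Q (m + 1) x A = ∫⁻ y, Q m y A ∂(P x))
    (ν : Measure X) (hν : ∀ A : Set X, MeasurableSet A → ∫⁻ x, P x A ∂ν = ν A)
    (A : Set X) (hA : MeasurableSet A) (m : ℕ) : ∫⁻ x, Q (m + 1) x A ∂ν = ν A := by
  have hb : ν.bind P = ν := by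
    ext B hB
    rw [Measure.bind_apply hB P.measurable.aemeasurable, hν B hB]
  induction m with
  | zero => rw [zero_add, hQ1]; exact hν A hA
  | succ k ih =>
    have h : ∀ x, Q (k + 1 + 1) x A = ∫⁻ y, Q (k + 1) y A ∂(P x) :=
      fun x => hQs (k + 1) (by omega) x A hA
    simp_rw [h]
    rw [← Measure.lintegral_bind P.measurable.aemeasurable
      ((Q (k + 1)).measurable_coe hA).aemeasurable, hb, ih]

lemma aux_eq {X : Type*} [MeasurableSpace X]
    (P : Kernel X X) (Q : ℕ → Kernel X X) (hQ1 : Q 1 = P)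
    (hQs : ∀ m, 1 ≤ m → ∀ x (A : Set X), MeasurableSet A →
      Q (m + 1) x A = ∫⁻ y, Q m y A ∂(P x))
    (S : Set X) (hS : MeasurableSet S) (hpos : ∀ x, 0 < ∑' m : ℕ, Q (m + 1) x S)
    (ρ m : Measure X) [IsFiniteMeasure m] (hle : m ≤ ρ) (heq : m S = ρ S)
    (hρ : ∀ A : Set X, MeasurableSet A → ∫⁻ x, P x A ∂ρ = ρ A)
    (hm : ∀ A : Set X, MeasurableSet A → ∫⁻ x, P x A ∂m = m A) : ρ = m := by
  have hadd : ρ - m + m = ρ := Measure.sub_add_cancel_of_le hle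
  set ν := ρ - m with hνdef
  have hν : ∀ A : Set X, MeasurableSet A → ∫⁻ x, P x A ∂ν = ν A := by
    intro A hA
    have h := hρ A hA
    rw [← hadd, lintegral_add_measure, hm A hA, Measure.add_apply] at h
    exact (ENNReal.add_left_inj (measure_ne_top m A)).1 h
  have hνS : ν S = 0 := by
    have h : (ν + m) S = ρ S := by rw [hadd]
    rw [Measure.add_apply, ← heq] at h
    have : ν S + m S = 0 + m S := by rw [h, zero_add]
    exact (ENNReal.add_left_inj (measure_ne_top m S)).1 this
  have hz : ∫⁻ x, ∑' k : ℕ, Q (k + 1) x S ∂ν = 0 := by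
    rw [lintegral_tsum fun k => ((Q (k + 1)).measurable_coe hS).aemeasurable]
    simp [aux_iter P Q hQ1 hQs ν hν S hS, hνS]
  rw [lintegral_eq_zero_iff (Measurable.ennreal_tsum fun k => (Q (k + 1)).measurable_coe hS)] at hz
  have hν0 : ν = 0 := by
    rw [← ae_eq_bot, ← Filter.eventually_false_iff_eq_bot]
    filter_upwards [hz] with x hx
    exact (hpos x).ne' hx
  rw [← hadd, hν0, zero_add]

lemma aux_hahn {X : Type*} [MeasurableSpace X] (μ ρ : Measure X) [SigmaFinite μ]
    [IsFiniteMeasure ρ] : ∃ S, MeasurableSet S ∧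
      (∀ A, MeasurableSet A → A ⊆ S → ρ A ≤ μ A) ∧
      (∀ A, MeasurableSet A → A ⊆ Sᶜ → μ A ≤ ρ A) := by
  have h1 : μ ≪ μ + ρ := Measure.absolutelyContinuous_of_le (Measure.le_add_right le_rfl)
  have h2 : ρ ≪ μ + ρ := Measure.absolutelyContinuous_of_le (Measure.le_add_left le_rfl)
  refine ⟨{x | ρ.rnDeriv (μ + ρ) x ≤ μ.rnDeriv (μ + ρ) x},
    measurableSet_le (Measure.measurable_rnDeriv _ _) (Measure.measurable_rnDeriv _ _), ?_, ?_⟩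
  · intro A hA hAS
    rw [← Measure.setLIntegral_rnDeriv h1 A, ← Measure.setLIntegral_rnDeriv h2 A]
    exact setLIntegral_mono' hA fun x hx => hAS hx
  · intro A hA hAS
    rw [← Measure.setLIntegral_rnDeriv h1 A, ← Measure.setLIntegral_rnDeriv h2 A]
    exact setLIntegral_mono' hA fun x hx => by
      have h : ¬ (ρ.rnDeriv (μ + ρ) x ≤ μ.rnDeriv (μ + ρ) x) := hAS hx
      exact (not_le.1 h).le

lemma aux_total {X : Type*} [MeasurableSpace X]
    (P : Kernel X X) [IsMarkovKernel P] (Q : ℕ → Kernel X X) (hQ1 : Q 1 = P)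
    (hQs : ∀ m, 1 ≤ m → ∀ x (A : Set X), MeasurableSet A →
      Q (m + 1) x A = ∫⁻ y, Q m y A ∂(P x))
    (hirr : ∃ φ : Measure X, SigmaFinite φ ∧ φ ≠ 0 ∧
      ∀ A : Set X, MeasurableSet A → 0 < φ A → ∀ x, 0 < ∑' m : ℕ, Q (m + 1) x A)
    (μ ρ : Measure X) [SigmaFinite μ] [IsFiniteMeasure ρ]
    (hμ : ∀ A : Set X, MeasurableSet A → ∫⁻ x, P x A ∂μ = μ A)
    (hρ : ∀ A : Set X, MeasurableSet A → ∫⁻ x, P x A ∂ρ = ρ A) : ρ ≤ μ ∨ μ ≤ ρ := by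
  obtain ⟨S, hS, hS1, hS2⟩ := aux_hahn μ ρ
  obtain ⟨φ, -, hφ0, hφ⟩ := hirr
  set m := ρ.restrict S + μ.restrict Sᶜ with hmdef
  have hmA : ∀ A, MeasurableSet A → m A = ρ (A ∩ S) + μ (A ∩ Sᶜ) := by
    intro A hA
    rw [hmdef, Measure.add_apply, Measure.restrict_apply hA, Measure.restrict_apply hA]
  have hsplit : ∀ (κ : Measure X) A, κ A = κ (A ∩ S) + κ (A ∩ Sᶜ) := by
    intro κ A
    rw [← Set.diff_eq, measure_inter_add_diff A hS]
  have hmρ : m ≤ ρ := by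
    rw [Measure.le_iff]
    intro A hA
    rw [hmA A hA, hsplit ρ A]
    exact add_le_add le_rfl (hS2 _ (hA.inter hS.compl) Set.inter_subset_right)
  have hmμ : m ≤ μ := by
    rw [Measure.le_iff]
    intro A hA
    rw [hmA A hA, hsplit μ A]
    exact add_le_add (hS1 _ (hA.inter hS) Set.inter_subset_right) le_rfl
  have : IsFiniteMeasure m := isFiniteMeasure_of_le ρ hmρ
  have hsub : ∀ A, MeasurableSet A → ∫⁻ x, P x A ∂m ≤ m A := by
    intro A hA
    have e : ∀ x, P x A = P x (A ∩ S) + P x (A ∩ Sᶜ) := fun x => hsplit _ _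
    simp_rw [e]
    rw [lintegral_add_left (P.measurable_coe (hA.inter hS)), hmA A hA]
    refine add_le_add ?_ ?_
    · rw [← hρ _ (hA.inter hS)]; exact lintegral_mono' hmρ le_rfl
    · rw [← hμ _ (hA.inter hS.compl)]; exact lintegral_mono' hmμ le_rfl
  have hinv : ∀ A, MeasurableSet A → ∫⁻ x, P x A ∂m = m A := by
    intro A hA
    refine le_antisymm (hsub A hA) ?_
    have h1 : ∫⁻ x, P x A ∂m + ∫⁻ x, P x Aᶜ ∂m = m A + m Aᶜ := by
      rw [← lintegral_add_left (P.measurable_coe hA), measure_add_measure_compl hA]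
      simp [measure_add_measure_compl hA]
    have h2 := hsub _ hA.compl
    have h3 : m A + m Aᶜ ≤ ∫⁻ x, P x A ∂m + m Aᶜ := by
      rw [← h1]; gcongr
    exact (ENNReal.add_le_add_iff_right (measure_ne_top m _)).1 h3
  have hφS : 0 < φ S ∨ 0 < φ Sᶜ := by
    by_contra! h
    apply hφ0
    rw [← Measure.measure_univ_eq_zero, ← measure_add_measure_compl hS]
    simp only [nonpos_iff_eq_zero] at h
    rw [h.1, h.2, add_zero]
  rcases hφS with h | h
  · left
    have := aux_eq P Q hQ1 hQs S hS (hφ S hS h) ρ m hmρ (by rw [hmA S hS]; simp) hρ hinv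
    rw [this]; exact hmμ
  · right
    have := aux_eq P Q hQ1 hQs Sᶜ hS.compl (hφ _ hS.compl h) μ m hmμ
      (by rw [hmA _ hS.compl]; simp) hμ hinv
    rw [this]; exact hmρ

/-- If a Markov kernel `P` (with `m`-step iterates `Q m`) is irreducible (there is a
nontrivial σ-finite measure `φ` such that `∑_{m≥1} Pᵐ(x,A) > 0` for every `x` whenever
`φ A > 0`) and admits an invariant probability measure `π`, then every σ-finite invariant
measure is a finite constant multiple of `π`; in particular `π` is the unique invariant
probability measure. -/
theorem stmt_7 {X : Type*} [MeasurableSpace X]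
    (P : Kernel X X) [IsMarkovKernel P]
    (Q : ℕ → Kernel X X)
    (hQ1 : Q 1 = P)
    (hQs : ∀ m, 1 ≤ m → ∀ x (A : Set X), MeasurableSet A →
      Q (m + 1) x A = ∫⁻ y, Q m y A ∂(P x))
    (hirr : ∃ φ : Measure X, SigmaFinite φ ∧ φ ≠ 0 ∧
      ∀ A : Set X, MeasurableSet A → 0 < φ A → ∀ x, 0 < ∑' m : ℕ, Q (m + 1) x A)
    (π : Measure X) [IsProbabilityMeasure π]
    (hπ : ∀ A : Set X, MeasurableSet A → ∫⁻ x, P x A ∂π = π A) :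
    (∀ μ : Measure X, SigmaFinite μ →
      (∀ A : Set X, MeasurableSet A → ∫⁻ x, P x A ∂μ = μ A) →
      ∃ c : ℝ≥0∞, c ≠ ⊤ ∧ μ = c • π) ∧
    (∀ π' : Measure X, IsProbabilityMeasure π' →
      (∀ A : Set X, MeasurableSet A → ∫⁻ x, P x A ∂π' = π' A) → π' = π) := by
  have key : ∀ μ : Measure X, SigmaFinite μ →
      (∀ A : Set X, MeasurableSet A → ∫⁻ x, P x A ∂μ = μ A) →
      ∃ c : ℝ≥0∞, c ≠ ⊤ ∧ μ = c • π := by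
    intro μ _ hμ
    have htot : ∀ c : ℝ≥0∞, c ≠ ⊤ → c • π ≤ μ ∨ μ ≤ c • π := by
      intro c hc
      have : IsFiniteMeasure (c • π) := Measure.smul_finite π hc
      refine aux_total P Q hQ1 hQs hirr μ (c • π) hμ ?_
      intro A hA
      rw [lintegral_smul_measure, hπ A hA, Measure.smul_apply]
    set T : Set ℝ≥0∞ := {c | c • π ≤ μ} with hT
    have hcT : ∀ A, sSup T * π A ≤ μ A := by
      intro A
      rw [ENNReal.sSup_mul]
      exact iSup₂_le fun c hc => hc A
    have hctop : sSup T ≠ ⊤ := by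
      intro h
      have hz : ∀ n, π (spanningSets μ n) = 0 := by
        intro n
        by_contra hn
        have := hcT (spanningSets μ n)
        rw [h, ENNReal.top_mul hn] at this
        exact (measure_spanningSets_lt_top μ n).not_ge this
      have h0 : π Set.univ = 0 := by
        rw [← iUnion_spanningSets μ]
        exact measure_iUnion_null hz
      simp at h0
    refine ⟨sSup T, hctop, le_antisymm ?_ ?_⟩
    · rw [Measure.le_iff]
      intro A hA
      rw [Measure.smul_apply, smul_eq_mul]
      refine ENNReal.le_of_forall_pos_le_add fun ε hε _ => ?_
      have hlt : sSup T < sSup T + ε :=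
        ENNReal.lt_add_right hctop (by exact_mod_cast hε.ne')
      have hnot : ¬ (sSup T + ε) • π ≤ μ := fun h => (le_sSup (a := sSup T + ε) h).not_gt hlt
      have hle := ((htot (sSup T + ε) (by simp [hctop])).resolve_left hnot) A
      rw [Measure.smul_apply, smul_eq_mul, add_mul] at hle
      refine hle.trans ?_
      gcongr
      exact mul_le_of_le_one_right' prob_le_one
    · rw [Measure.le_iff]
      intro A hA
      exact hcT A
  refine ⟨key, ?_⟩
  intro π' _ h'
  obtain ⟨c, -, hc⟩ := key π' inferInstance h'
  have h1 : π' Set.univ = c * π Set.univ := by rw [hc]; rfl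
  simp only [measure_univ, mul_one] at h1
  rw [hc, ← h1, one_smul]
end

section
/- Let U⊆ℂ be open, T∈(0,∞], and W:[0,T)→ℝ continuous. Let g:[0,T)×U→ℂ be jointly continuous such that for each t∈[0,T) the map z↦g(t,z) is holomorphic on U, g(t,z)≠W(t) for all (t,z)∈[0,T)×U, and for each z∈U the map t↦g(t,z) is differentiable with ∂_t g(t,z) = 2/(g(t,z)−W(t)) (the chordal Loewner equation). Then for each z∈U, the map t↦∂_z g(t,z) (the spatial complex derivative) is differentiable in t and satisfies ∂_t ∂_z g(t,z) = −2·∂_z g(t,z)/(g(t,z)−W(t))², with ∂_z g(0,z)=1 when g(0,z)=z. -/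
/-- Differentiating the chordal Loewner equation in the spatial variable: if
`g : [0,T) × U → ℂ` is jointly continuous, holomorphic in `z ∈ U` for each time,
avoids the driving function `W`, and satisfies `∂_t g(t,z) = 2/(g(t,z) - W(t))`, then
`t ↦ ∂_z g(t,z)` is differentiable in `t` with
`∂_t ∂_z g(t,z) = -2 ∂_z g(t,z)/(g(t,z) - W(t))²`; moreover `∂_z g(0,z) = 1`
when `g(0,·) = id` on `U`. -/
theorem stmt_9 (U : Set ℂ) (hU : IsOpen U) (T : EReal) (hT : 0 < T)
    (W : ℝ → ℝ) (hW : ContinuousOn W {t : ℝ | 0 ≤ t ∧ (t : EReal) < T})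
    (g : ℝ → ℂ → ℂ)
    (hg_cont : ContinuousOn (fun p : ℝ × ℂ => g p.1 p.2)
      ({t : ℝ | 0 ≤ t ∧ (t : EReal) < T} ×ˢ U))
    (hg_holo : ∀ t : ℝ, 0 ≤ t → (t : EReal) < T → DifferentiableOn ℂ (g t) U)
    (hg_ne : ∀ t : ℝ, 0 ≤ t → (t : EReal) < T → ∀ z ∈ U, g t z ≠ (W t : ℂ))
    (hg_ode : ∀ z ∈ U, ∀ t : ℝ, 0 ≤ t → (t : EReal) < T →
      HasDerivWithinAt (fun s => g s z) (2 / (g t z - (W t : ℂ)))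
        {s : ℝ | 0 ≤ s ∧ (s : EReal) < T} t) :
    (∀ z ∈ U, ∀ t : ℝ, 0 ≤ t → (t : EReal) < T →
      HasDerivWithinAt (fun s => deriv (g s) z)
        (-2 * deriv (g t) z / (g t z - (W t : ℂ)) ^ 2)
        {s : ℝ | 0 ≤ s ∧ (s : EReal) < T} t) ∧
    ((∀ z ∈ U, g 0 z = z) → ∀ z ∈ U, deriv (g 0) z = 1) := by
  set I : Set ℝ := {t : ℝ | 0 ≤ t ∧ (t : EReal) < T} with hI
  have hconv : Convex ℝ I := by
    apply Set.OrdConnected.convex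
    refine ⟨fun x hx y hy w hw => ⟨hx.1.trans hw.1, lt_of_le_of_lt ?_ hy.2⟩⟩
    exact_mod_cast hw.2
  have hv : ContinuousOn (fun p : ℝ × ℂ => 2 / (g p.1 p.2 - (W p.1 : ℂ))) (I ×ˢ U) := by
    refine ContinuousOn.div continuousOn_const (hg_cont.sub ?_) ?_
    · refine Complex.continuous_ofReal.comp_continuousOn ?_
      exact hW.comp continuousOn_fst (fun p hp => hp.1)
    · intro p hp
      exact sub_ne_zero.mpr (hg_ne p.1 hp.1.1 hp.1.2 p.2 hp.2)
  constructor
  · intro z hz t ht0 htT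
    have htI : t ∈ I := ⟨ht0, htT⟩
    have hlu : TendstoLocallyUniformlyOn
        (fun (s : ℝ) (w : ℂ) => (((s - t)⁻¹ : ℝ) : ℂ) * (g s w - g t w))
        (fun w => 2 / (g t w - (W t : ℂ))) (nhdsWithin t (I \ {t})) U := by
      rw [Metric.tendstoLocallyUniformlyOn_iff]
      intro ε hε x hx
      have hc := Metric.continuousWithinAt_iff.mp (hv (t, x) ⟨htI, hx⟩) (ε / 4) (by positivity)
      obtain ⟨δ, hδ, hc⟩ := hc
      refine ⟨Metric.ball x δ ∩ U, ?_, ?_⟩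
      · exact Filter.inter_mem (mem_nhdsWithin_of_mem_nhds (Metric.ball_mem_nhds x hδ))
          self_mem_nhdsWithin
      · have h1 : ∀ᶠ s in nhdsWithin t (I \ {t}), s ∈ Metric.ball t δ :=
          mem_nhdsWithin_of_mem_nhds (Metric.ball_mem_nhds t hδ)
        filter_upwards [h1, self_mem_nhdsWithin] with s hs hsI w hw
        have hst : s - t ≠ 0 := sub_ne_zero.mpr hsI.2
        have hb : ∀ r ∈ I ∩ Metric.ball t δ,
            ‖2 / (g r w - (W r : ℂ)) - 2 / (g t w - (W t : ℂ))‖ ≤ ε / 2 := by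
          intro r hr
          have e1 := hc (x := (r, w)) ⟨hr.1, hw.2⟩ (by
            rw [Prod.dist_eq]; exact max_lt hr.2 hw.1)
          have e2 := hc (x := (t, w)) ⟨htI, hw.2⟩ (by
            rw [Prod.dist_eq]; exact max_lt (by simpa using hδ) hw.1)
          rw [← dist_eq_norm]
          have e3 := dist_triangle_right (2 / (g r w - (W r : ℂ))) (2 / (g t w - (W t : ℂ)))
            (2 / (g t x - (W t : ℂ)))
          simp only at e1 e2
          linarith
        set c : ℂ := 2 / (g t w - (W t : ℂ)) with hcdef
        have hder : ∀ r ∈ I ∩ Metric.ball t δ,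
            HasDerivWithinAt (fun r : ℝ => g r w - (r : ℂ) * c)
              (2 / (g r w - (W r : ℂ)) - c) (I ∩ Metric.ball t δ) r := by
          intro r hr
          have d1 := (hg_ode w hw.2 r hr.1.1 hr.1.2).mono
            (Set.inter_subset_left (s := I) (t := Metric.ball t δ))
          have d2 : HasDerivAt (fun r : ℝ => (r : ℂ) * c) (1 * c) r :=
            (Complex.ofRealCLM.hasDerivAt (x := r)).mul_const c
          rw [one_mul] at d2
          exact d1.sub d2.hasDerivWithinAt
        have hmv := (hconv.inter (convex_ball t δ)).norm_image_sub_le_of_norm_hasDerivWithin_le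
          hder hb ⟨htI, Metric.mem_ball_self hδ⟩ ⟨hsI.1, hs⟩
        have hst' : ((s : ℂ) - t) ≠ 0 := by exact_mod_cast hst
        have hpos : 0 < ‖s - t‖ := norm_pos_iff.mpr hst
        rw [dist_comm, dist_eq_norm]
        have heq : (((s - t)⁻¹ : ℝ) : ℂ) * (g s w - g t w) - c
            = (((s - t)⁻¹ : ℝ) : ℂ) * ((g s w - s * c) - (g t w - t * c)) := by
          push_cast
          field_simp
          ring
        rw [heq, norm_mul, Complex.norm_real, norm_inv]
        calc ‖s - t‖⁻¹ * ‖(g s w - s * c) - (g t w - t * c)‖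
            ≤ ‖s - t‖⁻¹ * (ε / 2 * ‖s - t‖) := by gcongr
          _ = ε / 2 := by field_simp
          _ < ε := by linarith
    have hd : ∀ s ∈ I, DifferentiableAt ℂ (g s) z := fun s hs =>
      (hg_holo s hs.1 hs.2).differentiableAt (hU.mem_nhds hz)
    have hlim := (hlu.deriv (by
      filter_upwards [self_mem_nhdsWithin] with s hs
      exact ((hg_holo s hs.1.1 hs.1.2).sub (hg_holo t ht0 htT)).const_mul _) hU).tendsto_at hz
    have hG : deriv (fun w => 2 / (g t w - (W t : ℂ))) z
        = -2 * deriv (g t) z / (g t z - (W t : ℂ)) ^ 2 := by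
      have h := (hasDerivAt_const z (2 : ℂ)).div ((hd t htI).hasDerivAt.sub_const (W t : ℂ))
        (sub_ne_zero.mpr (hg_ne t ht0 htT z hz))
      refine Eq.trans h.deriv ?_
      ring
    rw [hasDerivWithinAt_iff_tendsto_slope, ← hG]
    refine hlim.congr' ?_
    filter_upwards [self_mem_nhdsWithin] with s hs
    have h := ((hd s hs.1).hasDerivAt.sub (hd t htI).hasDerivAt).const_mul
      ((((s - t)⁻¹ : ℝ) : ℂ))
    rw [slope_def_module, Complex.real_smul]
    exact h.deriv
  · intro h z hz
    have : g 0 =ᶠ[nhds z] id := by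
      filter_upwards [hU.mem_nhds hz] with w hw using h w hw
    rw [this.deriv_eq, deriv_id]
end
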